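/- There exists a singly even self-dual binary [88,44] code with minimum weight 16 whose weight distribution is lexicographically smaller than the weight distribution of every doubly even self-dual binary [88,44] code with minimum weight 16 (in particular, such a singly even code has 18436 codewords of weight 16, while every such doubly even code has 32164 codewords of weight 16). -/

import Mathlib

/-- The (Hamming) weight of a vector over `ZMod 2`. -/
def wt {ι : Type*} [Fintype ι] (x : ι → ZMod 2) : ℕ :=
  (Finset.univ.filter fun i => x i ≠ 0).card

/-- The dual code of a binary linear code. -/
def dualCode {ι : Type*} [Fintype ι] (C : Submodule (ZMod 2) (ι → ZMod 2)) :
    Submodule (ZMod 2) (ι → ZMod 2) where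
  carrier := {x | ∀ c ∈ C, ∑ i, x i * c i = 0}
  zero_mem' := by intro c _; simp
  add_mem' := by
    intro a b ha hb c hc
    simp only [Set.mem_setOf_eq] at ha hb ⊢
    simp [Pi.add_apply, add_mul, Finset.sum_add_distrib, ha c hc, hb c hc]
  smul_mem' := by
    intro r a ha c hc
    simp only [Set.mem_setOf_eq] at ha ⊢
    simp [Pi.smul_apply, smul_eq_mul, mul_assoc, ← Finset.mul_sum, ha c hc]

/-- A binary linear code is self-dual if it equals its dual. -/
def IsSelfDual {ι : Type*} [Fintype ι] (C : Submodule (ZMod 2) (ι → ZMod 2)) : Prop :=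
  C = dualCode C

/-- A binary code is even if every codeword has even weight. -/
def IsEvenCode {ι : Type*} [Fintype ι] (C : Submodule (ZMod 2) (ι → ZMod 2)) : Prop :=
  ∀ c ∈ C, 2 ∣ wt c

/-- `C` has minimum weight `d`: some nonzero codeword has weight `d` and
no nonzero codeword has smaller weight. -/
def HasMinWt {ι : Type*} [Fintype ι] (C : Submodule (ZMod 2) (ι → ZMod 2)) (d : ℕ) : Prop :=
  (∃ c ∈ C, c ≠ 0 ∧ wt c = d) ∧ ∀ c ∈ C, c ≠ 0 → d ≤ wt c

/-- `Awt C i` is the number `A_i(C)` of codewords of `C` of weight `i`. -/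
noncomputable def Awt {ι : Type*} [Fintype ι]
    (C : Submodule (ZMod 2) (ι → ZMod 2)) (i : ℕ) : ℕ :=
  Set.ncard {c ∈ (C : Set (ι → ZMod 2)) | wt c = i}

/-- `C` performs better than `C'`: the weight distribution of `C` is
lexicographically smaller than that of `C'`. -/
def LexSmaller {ι : Type*} [Fintype ι]
    (C C' : Submodule (ZMod 2) (ι → ZMod 2)) : Prop :=
  ∃ s : ℕ, (∀ i < s, Awt C i = Awt C' i) ∧ Awt C s < Awt C' s

/-- A circulant matrix: each row is the cyclic shift (by one position) of the previous one,
equivalently the matrix is invariant under simultaneously cyclically shifting rows and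
columns. -/
def IsCirculant {n : ℕ} (R : Matrix (Fin n) (Fin n) (ZMod 2)) : Prop :=
  ∀ i j k : Fin n, R (i + k) (j + k) = R i j

/-- The generator matrix `(I_n | R)`. -/
def genMat {n : ℕ} (R : Matrix (Fin n) (Fin n) (ZMod 2)) :
    Matrix (Fin n) (Fin n ⊕ Fin n) (ZMod 2) :=
  Matrix.of fun i => Sum.elim (fun j => if i = j then (1 : ZMod 2) else 0) (R i)

/-- The row space (span of the rows) of a matrix over `ZMod 2`. -/
def rowSpan {ι κ : Type*} (M : Matrix ι κ (ZMod 2)) : Submodule (ZMod 2) (κ → ZMod 2) :=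
  Submodule.span (ZMod 2) (Set.range M)

/-- The bordered matrix `B` with `B 0 0 = α`, the rest of the first row and first
column all ones, and remaining block the matrix `R'`. -/
def borderMat {m : ℕ} (α : ZMod 2) (R' : Matrix (Fin m) (Fin m) (ZMod 2)) :
    Matrix (Fin (m + 1)) (Fin (m + 1)) (ZMod 2) :=
  Matrix.of fun i j =>
    if hi : i = 0 then (if j = 0 then α else 1)
    else if hj : j = 0 then 1
    else R' (i.pred hi) (j.pred hj)

/-- `C` is a pure double circulant code of length `2n`. -/
def IsPureDC {n : ℕ} (C : Submodule (ZMod 2) (Fin n ⊕ Fin n → ZMod 2)) : Prop :=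
  ∃ R : Matrix (Fin n) (Fin n) (ZMod 2), IsCirculant R ∧ C = rowSpan (genMat R)

/-- `C` is a bordered double circulant code of length `2(m+1)`. -/
def IsBorderedDC {m : ℕ} (C : Submodule (ZMod 2) (Fin (m + 1) ⊕ Fin (m + 1) → ZMod 2)) : Prop :=
  ∃ (α : ZMod 2) (R' : Matrix (Fin m) (Fin m) (ZMod 2)),
    IsCirculant R' ∧ C = rowSpan (genMat (borderMat α R'))

/-- `C` is a double circulant code: pure or bordered. -/
def IsDC {m : ℕ} (C : Submodule (ZMod 2) (Fin (m + 1) ⊕ Fin (m + 1) → ZMod 2)) : Prop :=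
  IsPureDC C ∨ IsBorderedDC C

/-- The dual of a set of vectors. -/
def dualSet {ι : Type*} [Fintype ι] (X : Set (ι → ZMod 2)) : Set (ι → ZMod 2) :=
  {x | ∀ c ∈ X, ∑ i, x i * c i = 0}

/-- The shadow `S = C_0^⊥ \ C` of `C`, where `C_0` is the doubly even subcode. -/
def shadowSet {ι : Type*} [Fintype ι] (C : Submodule (ZMod 2) (ι → ZMod 2)) :
    Set (ι → ZMod 2) :=
  dualSet {c ∈ (C : Set (ι → ZMod 2)) | 4 ∣ wt c} \ (C : Set (ι → ZMod 2))

namespace BitSlice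

/-- All exclusive-or sums of `k` entries of a list of words. -/
def combos : List ℕ → ℕ → List ℕ
  | _, 0 => [0]
  | [], _ + 1 => []
  | r :: rs, k + 1 => combos rs (k + 1) ++ (combos rs k).map (r ^^^ ·)

/-- The number whose binary digits, least significant first, are the given booleans. -/
def pack : List Bool → ℕ
  | [] => 0
  | b :: l => 2 * pack l + b.toNat

/-- The slice of a Boolean function `f` along a list of words. -/
def slice {α : Type*} (W : List α) (f : α → Bool) : ℕ := pack (W.map f)

/-- The least significant 44 bits of words, sliced along a list. -/
def bitSlices (W : List ℕ) (j n : ℕ) : List ℕ :=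
  (List.range' j n).map fun i => slice W fun w => w.testBit i

/-- Number of nonzero bits among the 44 least significant ones. -/
def pop (w : ℕ) : ℕ := ((List.range' 0 44).map fun j => (w.testBit j).toNat).sum

/-- Translate sliced words by the word `r`; `m` is the all-one slice. -/
def flipL (m : ℕ) : ℕ → List ℕ → List ℕ
  | _, [] => []
  | r, x :: xs => Nat.xor x (Nat.mul m (Nat.mod r 2)) :: flipL m (Nat.div r 2) xs

/-- Concatenate sliced lists of words, the first one having `n` entries. -/
def appendL (n : ℕ) : List ℕ → List ℕ → List ℕ
  | x :: xs, y :: ys => Nat.add x (Nat.shiftLeft y n) :: appendL n xs ys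
  | _, _ => []

/-- Add two sliced numbers and a sliced carry. -/
def addc : List ℕ → List ℕ → ℕ → List ℕ
  | x :: xs, y :: ys, c =>
    (fun t => Nat.xor t c :: addc xs ys (Nat.lor (Nat.land x y) (Nat.land t c))) (Nat.xor x y)
  | _, _, c => [c]

/-- The `d`-digit sliced number of nonzero bits of at most `2 ^ d - 1` slices. -/
def popL : ℕ → List ℕ → List ℕ
  | 0, _ => []
  | d + 1, [] => 0 :: popL d []
  | d + 1, x :: xs => addc (popL d (xs.take (2 ^ d - 1))) (popL d (xs.drop (2 ^ d - 1))) x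

/-- Compare the constant `c` with a sliced number; `a` decides ties. -/
def leL : ℕ → List ℕ → ℕ → ℕ
  | _, [], a => a
  | c, x :: xs, a =>
    leL (Nat.div c 2) xs (bif Nat.beq (Nat.mod c 2) 1 then Nat.land x a else Nat.lor x a)

/-- The number of nonzero bits of a number with at most `2 ^ d` bits. -/
def popc : ℕ → ℕ → ℕ
  | 0, x => x
  | d + 1, x => bif Nat.beq x 0 then 0 else
    (fun h => Nat.add (popc d (Nat.sub x (Nat.shiftLeft h (Nat.pow 2 d)))) (popc d h))
      (Nat.shiftRight x (Nat.pow 2 d))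

/-- The counting function on sliced words: words `w` (translated by `u`) with `32 + i ≤ pop w`
count `1`, and words with `pop w < 16 - i` or `33 + i ≤ pop w` count `2 ^ 20`. -/
def leafCount (i u : ℕ) (b : ℕ × List ℕ) : ℕ :=
  (fun m => (fun cs =>
    Nat.add (popc 24 (leL (32 + i) cs m)) (Nat.mul 1048576
      (popc 24 (Nat.lor (Nat.xor m (leL (16 - i) cs m)) (leL (33 + i) cs m)))))
    (popL 6 (flipL m u b.2))) (Nat.sub (Nat.shiftLeft 1 b.1) 1)

/-- Auxiliary function for `table`. -/
def stepTable (r : ℕ) : ℕ × List ℕ → List (ℕ × List ℕ) → List (ℕ × List ℕ)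
  | _, [] => []
  | p, b :: bs => (Nat.add b.1 p.1,
      appendL b.1 b.2 (flipL (Nat.sub (Nat.shiftLeft 1 p.1) 1) r p.2)) :: stepTable r b bs

/-- The sliced lists `combos rs i` for `i ≤ k`. -/
def table (k : ℕ) : List ℕ → List (ℕ × List ℕ)
  | [] => (1, List.replicate 44 0) :: List.replicate k (0, List.replicate 44 0)
  | r :: rs => match table k rs with
    | [] => []
    | b :: bs => b :: stepTable r b bs

/-- Sum of `leafCount` over the translates of tabulated lists by sums of outer words. -/
def outerCount (i : ℕ) (t : List (ℕ × List ℕ)) : List ℕ → ℕ → ℕ → ℕ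
  | [], k, u => leafCount i u (t.getD k (0, []))
  | _ :: rs, 0, u => outerCount i t rs 0 u
  | r :: rs, k + 1, u =>
    Nat.add (outerCount i t rs (k + 1) u) (outerCount i t rs k (Nat.xor u r))

/-- `leafCount`, evaluated on `combos (out ++ base) i`. -/
def count (out base : List ℕ) (i : ℕ) : ℕ := outerCount i (table i base) out i 0

section pack

theorem pack_lt (l : List Bool) : pack l < 2 ^ l.length := by
  induction l with
  | nil => simp [pack]
  | cons b l ih => cases b <;> simp [pack, pow_succ] <;> omega

theorem pack_append (l l' : List Bool) : pack (l ++ l') = pack l + 2 ^ l.length * pack l' := by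
  induction l with
  | nil => simp [pack]
  | cons b l ih => simp only [List.cons_append, pack, ih, List.length_cons, pow_succ]; ring

theorem testBit_pack (l : List Bool) (i : ℕ) : (pack l).testBit i = l.getD i false := by
  induction l generalizing i with
  | nil => simp [pack]
  | cons b l ih =>
    cases i with
    | zero => cases b <;> simp [pack]
    | succ i =>
      rw [Nat.testBit_succ, pack]
      have : (2 * pack l + b.toNat) / 2 = pack l := by cases b <;> (simp; try omega)
      rw [this, ih]; simp

theorem testBit_slice {α : Type*} (W : List α) (f : α → Bool) (i : ℕ) :
    (slice W f).testBit i = (W[i]?.map f).getD false := by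
  rw [slice, testBit_pack, List.getD_eq_getElem?_getD, List.getElem?_map]

variable {α : Type*} (W : List α)

theorem xor_slice (f g : α → Bool) :
    Nat.xor (slice W f) (slice W g) = slice W fun w => f w ^^ g w := by
  apply Nat.eq_of_testBit_eq; intro i
  change (slice W f ^^^ slice W g).testBit i = _
  rw [Nat.testBit_xor]; simp only [testBit_slice]
  cases W[i]? <;> simp

theorem land_slice (f g : α → Bool) :
    Nat.land (slice W f) (slice W g) = slice W fun w => f w && g w := by
  apply Nat.eq_of_testBit_eq; intro i
  change (slice W f &&& slice W g).testBit i = _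
  rw [Nat.testBit_and]; simp only [testBit_slice]
  cases W[i]? <;> simp

theorem lor_slice (f g : α → Bool) :
    Nat.lor (slice W f) (slice W g) = slice W fun w => f w || g w := by
  apply Nat.eq_of_testBit_eq; intro i
  change (slice W f ||| slice W g).testBit i = _
  rw [Nat.testBit_or]; simp only [testBit_slice]
  cases W[i]? <;> simp

theorem slice_false : slice W (fun _ => false) = 0 := by
  apply Nat.eq_of_testBit_eq; intro i
  rw [testBit_slice]; cases W[i]? <;> simp

theorem slice_true : slice W (fun _ => true) = Nat.sub (Nat.shiftLeft 1 W.length) 1 := by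
  change _ = (1 <<< W.length) - 1
  rw [Nat.one_shiftLeft]
  induction W with
  | nil => simp [slice, pack]
  | cons a W ih =>
    have h : slice (a :: W) (fun _ => true) = 2 * slice W (fun _ => true) + 1 := by
      simp [slice, pack]
    have := Nat.one_le_two_pow (n := W.length)
    rw [h, ih, List.length_cons, pow_succ]; omega

theorem slice_append (W' : List α) (f : α → Bool) :
    slice (W ++ W') f = Nat.add (slice W f) (Nat.shiftLeft (slice W' f) W.length) := by
  change _ = slice W f + (slice W' f) <<< W.length
  rw [slice, List.map_append, pack_append, Nat.shiftLeft_eq, List.length_map, mul_comm]; rfl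

theorem slice_map {β : Type*} (h : β → α) (V : List β) (f : α → Bool) :
    slice (V.map h) f = slice V (f ∘ h) := by
  simp [slice]

theorem popc_pack (d : ℕ) (l : List Bool) (hl : l.length ≤ 2 ^ d) :
    popc d (pack l) = l.count true := by
  induction d generalizing l with
  | zero =>
    match l with
    | [] => rfl
    | [b] => cases b <;> rfl
    | _ :: _ :: _ => simp at hl
  | succ d ih =>
    have hsplit : pack l = pack (l.take (2 ^ d)) + 2 ^ (2 ^ d) * pack (l.drop (2 ^ d)) := by
      rcases le_or_gt (2 ^ d) l.length with h | h
      · conv_lhs => rw [← List.take_append_drop (2 ^ d) l, pack_append]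
        rw [List.length_take, min_eq_left h]
      · rw [List.take_of_length_le h.le, List.drop_of_length_le h.le]; simp [pack]
    have hlt : pack (l.take (2 ^ d)) < 2 ^ (2 ^ d) :=
      (pack_lt _).trans_le (Nat.pow_le_pow_right two_pos (by simp))
    have hshift : Nat.shiftRight (pack l) (Nat.pow 2 d) = pack (l.drop (2 ^ d)) := by
      change pack l >>> (2 ^ d) = _
      rw [Nat.shiftRight_eq_div_pow, hsplit, Nat.add_mul_div_left _ _ (by positivity),
        Nat.div_eq_of_lt hlt, zero_add]
    have hsub : Nat.sub (pack l) (Nat.shiftLeft (pack (l.drop (2 ^ d))) (Nat.pow 2 d))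
        = pack (l.take (2 ^ d)) := by
      change pack l - (pack (l.drop (2 ^ d))) <<< (2 ^ d) = _
      rw [Nat.shiftLeft_eq, mul_comm]; omega
    have hcount : l.count true = (l.take (2 ^ d)).count true + (l.drop (2 ^ d)).count true := by
      conv_lhs => rw [← List.take_append_drop (2 ^ d) l, List.count_append]
    simp only [popc]
    rw [hshift, hsub, ih _ (by simp), ih _ (by simp [pow_succ] at hl ⊢; omega), hcount]
    cases h : Nat.beq (pack l) 0 with
    | false => rfl
    | true =>
      have h0 : pack l = 0 := Nat.eq_of_beq_eq_true h
      symm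
      rw [cond_true, ← hcount, List.count_eq_zero]
      intro hmem
      obtain ⟨i, hi, hi'⟩ := List.getElem_of_mem hmem
      have := testBit_pack l i
      rw [h0, Nat.zero_testBit, List.getD_eq_getElem _ _ hi, hi'] at this
      exact Bool.noConfusion this

theorem popc_slice (d : ℕ) (f : α → Bool) (hW : W.length ≤ 2 ^ d) :
    popc d (slice W f) = W.countP f := by
  rw [slice, popc_pack d _ (by simpa using hW), List.count_eq_countP, List.countP_map]
  congr 1; ext w; simp

end pack

section sliced

variable {α : Type*} (W : List α)

/-- The `n` least significant digits of `g`, sliced along `W`. -/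
def digits : ℕ → (α → ℕ) → List ℕ
  | 0, _ => []
  | n + 1, g => slice W (fun w => (g w).testBit 0) :: digits n fun w => g w / 2

theorem digits_congr (n : ℕ) {g h : α → ℕ} (H : ∀ w, g w = h w) :
    digits W n g = digits W n h := by
  rw [funext H]

theorem addc_digits (n : ℕ) (g h : α → ℕ) (c : α → Bool) :
    addc (digits W n g) (digits W n h) (slice W c) =
      digits W (n + 1) fun w => g w % 2 ^ n + h w % 2 ^ n + (c w).toNat := by
  induction n generalizing g h c with
  | zero =>
    simp only [digits, addc, pow_zero, Nat.mod_one]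
    congr 2; ext w; cases c w <;> simp
  | succ n ih =>
    simp only [digits, addc, xor_slice, land_slice, lor_slice, ih]
    have key : ∀ w, (g w % 2 ^ (n + 1) + h w % 2 ^ (n + 1) + (c w).toNat).testBit 0 =
        (((g w).testBit 0 ^^ (h w).testBit 0) ^^ c w) ∧
        (g w % 2 ^ (n + 1) + h w % 2 ^ (n + 1) + (c w).toNat) / 2 =
        g w / 2 % 2 ^ n + h w / 2 % 2 ^ n +
        (((g w).testBit 0 && (h w).testBit 0) ||
          (((g w).testBit 0 ^^ (h w).testBit 0) && c w)).toNat := by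
      intro w
      have e : ∀ a : ℕ, a % 2 ^ (n + 1) = a % 2 + 2 * (a / 2 % 2 ^ n) := fun a => by
        rw [pow_succ', Nat.mod_mul]
      rw [e, e]
      simp only [Nat.testBit_zero]
      rcases Nat.mod_two_eq_zero_or_one (g w) with hg | hg <;>
      rcases Nat.mod_two_eq_zero_or_one (h w) with hh | hh <;>
      cases c w <;> simp [hg, hh] <;> omega
    have h0 := fun w => (key w).1
    have h1 := fun w => (key w).2
    simp only [h0, h1]

theorem sum_toNat_le (fs : List (α → Bool)) (w : α) :
    (fs.map fun f => (f w).toNat).sum ≤ fs.length := by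
  induction fs with
  | nil => simp
  | cons f l ih => cases hf : f w <;> simp [hf] <;> omega

theorem popL_slice (d : ℕ) (fs : List (α → Bool)) (h : fs.length < 2 ^ d) :
    popL d (fs.map (slice W)) = digits W d fun w => (fs.map fun f => (f w).toNat).sum := by
  induction d generalizing fs with
  | zero => rfl
  | succ d ih =>
    match fs with
    | [] =>
      have := ih [] (by simp)
      simp only [List.map_nil, List.sum_nil] at this
      simp [popL, this, digits, slice_false]
    | f :: fs =>
      have hpow : 2 ^ (d + 1) = 2 * 2 ^ d := pow_succ' 2 d
      have hp : 1 ≤ 2 ^ d := Nat.one_le_two_pow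
      simp only [List.length_cons] at h
      have h1 : (fs.take (2 ^ d - 1)).length < 2 ^ d := by rw [List.length_take]; omega
      have h2 : (fs.drop (2 ^ d - 1)).length < 2 ^ d := by rw [List.length_drop]; omega
      rw [List.map_cons, popL, ← List.map_take, ← List.map_drop, ih _ h1, ih _ h2, addc_digits]
      apply digits_congr
      intro w
      rw [Nat.mod_eq_of_lt ((sum_toNat_le _ w).trans_lt h1), Nat.mod_eq_of_lt ((sum_toNat_le _ w).trans_lt h2),
        ← List.sum_append, ← List.map_append, List.take_append_drop, List.map_cons, List.sum_cons,
        add_comm]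

theorem leL_digits (n c : ℕ) (g : α → ℕ) (a : α → Bool) :
    leL c (digits W n g) (slice W a) = slice W fun w =>
      decide (c % 2 ^ n < g w % 2 ^ n) || (decide (c % 2 ^ n = g w % 2 ^ n) && a w) := by
  induction n generalizing c g a with
  | zero => simp [digits, leL, Nat.mod_one]
  | succ n ih =>
    have e : ∀ a : ℕ, a % 2 ^ (n + 1) = a % 2 + 2 * (a / 2 % 2 ^ n) := fun a => by
      rw [pow_succ', Nat.mod_mul]
    simp only [digits, leL]
    have hbeq : Nat.beq (Nat.mod c 2) 1 = decide (c % 2 = 1) := by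
      change Nat.beq (c % 2) 1 = _
      rcases Nat.mod_two_eq_zero_or_one c with hc | hc <;> rw [hc] <;> rfl
    have hcond : (bif Nat.beq (Nat.mod c 2) 1
        then Nat.land (slice W fun w => (g w).testBit 0) (slice W a)
        else Nat.lor (slice W fun w => (g w).testBit 0) (slice W a)) =
        slice W fun w => bif decide (c % 2 = 1) then (g w).testBit 0 && a w
          else (g w).testBit 0 || a w := by
      rw [hbeq, land_slice, lor_slice]
      rcases Nat.mod_two_eq_zero_or_one c with hc | hc <;> simp [hc]
    rw [hcond, ih]
    congr 1; ext w
    change (decide (c / 2 % 2 ^ n < g w / 2 % 2 ^ n) ||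
      (decide (c / 2 % 2 ^ n = g w / 2 % 2 ^ n) && _)) = _
    rw [e c, e (g w), Nat.testBit_zero]
    generalize c / 2 % 2 ^ n = p
    generalize g w / 2 % 2 ^ n = q
    rcases Nat.mod_two_eq_zero_or_one c with hc | hc <;>
    rcases Nat.mod_two_eq_zero_or_one (g w) with hg | hg <;> rw [hc, hg] <;> cases a w <;>
    rw [Bool.eq_iff_iff] <;> simp <;> omega

end sliced

section words

variable (W : List ℕ)

theorem flipL_bitSlices (r j n : ℕ) :
    flipL (slice W fun _ => true) (r / 2 ^ j) (bitSlices W j n) =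
      bitSlices (W.map (r ^^^ ·)) j n := by
  induction n generalizing j with
  | zero => rfl
  | succ n ih =>
    have := ih (j + 1)
    simp only [bitSlices, List.range'_succ, List.map_cons, flipL] at this ⊢
    have hdiv : Nat.div (r / 2 ^ j) 2 = r / 2 ^ (j + 1) := by
      change r / 2 ^ j / 2 = _
      rw [Nat.div_div_eq_div_mul, pow_succ]
    rw [hdiv, this]
    congr 1
    rw [slice_map]
    have hbit : Nat.mod (r / 2 ^ j) 2 = (r.testBit j).toNat := by
      change r / 2 ^ j % 2 = _
      rw [Nat.toNat_testBit]
    rw [hbit]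
    cases hr : r.testBit j with
    | false =>
      change slice W _ ^^^ (slice W _ * 0) = _
      rw [mul_zero, Nat.xor_zero]
      congr 1; ext w; simp [hr]
    | true =>
      change Nat.xor (slice W _) (slice W _ * 1) = _
      rw [mul_one, xor_slice]
      congr 1; ext w; simp [hr]

theorem appendL_bitSlices (W' : List ℕ) (j n : ℕ) :
    appendL W.length (bitSlices W j n) (bitSlices W' j n) = bitSlices (W ++ W') j n := by
  induction n generalizing j with
  | zero => rfl
  | succ n ih =>
    have := ih (j + 1)
    simp only [bitSlices, List.range'_succ, List.map_cons, appendL] at this ⊢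
    rw [this, slice_append]

/-- The tabulated form of a list of words. -/
def block : ℕ × List ℕ := (W.length, bitSlices W 0 44)

theorem pop_lt (w : ℕ) : pop w < 64 := by
  have := sum_toNat_le ((List.range' 0 44).map fun j (w : ℕ) => w.testBit j) w
  rw [List.map_map, List.length_map, List.length_range'] at this
  exact lt_of_le_of_lt this (by norm_num)

theorem popL_bitSlices : popL 6 (bitSlices W 0 44) = digits W 6 pop := by
  have := popL_slice W 6 ((List.range' 0 44).map fun i w => w.testBit i) (by simp)
  simp only [List.map_map] at this
  exact this

theorem leL_digits_pop {c : ℕ} (hc : c < 64) :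
    leL c (digits W 6 pop) (slice W fun _ => true) = slice W fun w => decide (c ≤ pop w) := by
  rw [leL_digits]
  refine congrArg (slice W) (funext fun w => ?_)
  rw [show 2 ^ 6 = 64 from rfl, Nat.mod_eq_of_lt hc, Nat.mod_eq_of_lt (pop_lt w), Bool.and_true, ← Bool.decide_or]
  simp only [le_iff_lt_or_eq]

theorem leafCount_block (i u : ℕ) (hi : i ≤ 7) (hW : W.length ≤ 2 ^ 24) :
    leafCount i u (block W) =
      (W.map (u ^^^ ·)).countP (fun w => 32 + i ≤ pop w) +
        2 ^ 20 * (W.map (u ^^^ ·)).countP (fun w => pop w < 16 - i ∨ 33 + i ≤ pop w) := by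
  have hcs := popL_bitSlices (W.map (u ^^^ ·))
  rw [← flipL_bitSlices, pow_zero, Nat.div_one] at hcs
  have hm : (slice W fun _ => true) = slice (W.map (u ^^^ ·)) fun _ => true := by
    rw [slice_map]; rfl
  have hV : (W.map (u ^^^ ·)).length ≤ 2 ^ 24 := by rwa [List.length_map]
  rw [leafCount, block, ← slice_true]
  beta_reduce
  rw [hcs, hm, leL_digits_pop _ (by omega), leL_digits_pop _ (by omega),
    leL_digits_pop _ (by omega), xor_slice, lor_slice, popc_slice _ _ _ hV, popc_slice _ _ _ hV,
    Nat.add_eq, Nat.mul_eq, show 1048576 = 2 ^ 20 by norm_num]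
  congr 3
  ext w
  by_cases h : 16 - i ≤ pop w <;> simp [h]
  omega

end words

section tables

theorem combos_nil (k : ℕ) : combos [] (k + 1) = [] := rfl

theorem combos_zero (rs : List ℕ) : combos rs 0 = [0] := by cases rs <;> rfl

theorem length_combos (rs : List ℕ) (k : ℕ) : (combos rs k).length = rs.length.choose k := by
  induction rs generalizing k with
  | nil => cases k <;> rfl
  | cons r rs ih =>
    cases k with
    | zero => simp [combos]
    | succ k => simp [combos, ih, Nat.choose_succ_succ, add_comm]

theorem stepTable_range (r : ℕ) (rs : List ℕ) (j n : ℕ) :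
    stepTable r (block (combos rs j)) ((List.range' (j + 1) n).map fun k => block (combos rs k)) =
      (List.range' (j + 1) n).map fun k => block (combos (r :: rs) k) := by
  induction n generalizing j with
  | zero => rfl
  | succ n ih =>
    simp only [List.range'_succ, List.map_cons, stepTable, ih]
    congr 1
    rw [combos, block, block, block, ← slice_true]
    have h1 := flipL_bitSlices (combos rs j) r 0 44
    rw [pow_zero, Nat.div_one] at h1
    simp only [h1, appendL_bitSlices]
    simp [add_comm]

theorem table_eq (k : ℕ) (rs : List ℕ) :
    table k rs = (List.range (k + 1)).map fun j => block (combos rs j) := by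
  rw [List.range_eq_range', List.range'_succ, List.map_cons, combos_zero]
  induction rs with
  | nil =>
    have h0 : block [0] = (1, List.replicate 44 0) := by decide
    have h1 : block [] = (0, List.replicate 44 0) := by decide
    rw [table, h0]
    congr 1
    rw [← h1]
    symm
    rw [List.eq_replicate_iff]
    refine ⟨by simp, fun b hb => ?_⟩
    obtain ⟨j, hj, rfl⟩ := List.mem_map.1 hb
    obtain ⟨j, rfl⟩ : ∃ m, j = m + 1 := ⟨j - 1, by simp at hj; omega⟩
    rw [combos_nil]
  | cons r rs ih =>
    rw [table, ih]
    simp only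
    congr 1
    rw [← stepTable_range, combos_zero]

theorem outerCount_eq (i : ℕ) (hi : i ≤ 7) (base : List ℕ)
    (hb : ∀ k ≤ i, base.length.choose k ≤ 2 ^ 24) (out : List ℕ) (k u : ℕ) (hk : k ≤ i) :
    outerCount i (table i base) out k u =
      ((combos (out ++ base) k).map (u ^^^ ·)).countP (fun w => 32 + i ≤ pop w) +
        2 ^ 20 * ((combos (out ++ base) k).map (u ^^^ ·)).countP
          (fun w => pop w < 16 - i ∨ 33 + i ≤ pop w) := by
  induction out generalizing k u with
  | nil =>
    rw [outerCount, table_eq, List.getD_eq_getElem _ _ (by simpa using hk), List.nil_append]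
    simp only [List.getElem_map, List.getElem_range]
    exact leafCount_block _ i u hi (by rw [length_combos]; exact hb k hk)
  | cons r out ih =>
    cases k with
    | zero =>
      rw [outerCount, ih _ _ hk, combos_zero, combos_zero]
    | succ k =>
      rw [outerCount, ih _ _ hk, ih _ _ (by omega), List.cons_append, combos, List.map_append,
        List.countP_append, List.countP_append, List.map_map]
      have : (fun x => u ^^^ x) ∘ (fun x => r ^^^ x) = fun x => Nat.xor u r ^^^ x := by
        ext x; exact (Nat.xor_assoc u r x).symm
      rw [this, Nat.add_eq]
      ring

theorem count_eq (out base : List ℕ) (i : ℕ) (hi : i ≤ 7)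
    (hb : ∀ k ≤ i, base.length.choose k ≤ 2 ^ 24) :
    count out base i = (combos (out ++ base) i).countP (fun w => 32 + i ≤ pop w) +
      2 ^ 20 * (combos (out ++ base) i).countP (fun w => pop w < 16 - i ∨ 33 + i ≤ pop w) := by
  have h : (fun x : ℕ => 0 ^^^ x) = id := by ext x; simp
  rw [count, outerCount_eq i hi base hb out i 0 le_rfl, h, List.map_id]

end tables

end BitSlice

namespace FourCirculant

open BitSlice

/-- The first six rows of the matrix `R`, as binary numbers. -/
def rowsHead : List ℕ := [
    14468492506859, 11344803163606, 5097420282797, 10194836371291, 2797490892470,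
    5594977590637]

/-- The remaining rows of the matrix `R`, as binary numbers. -/
def rowsTail : List ℕ := [
    11189950986971, 4787720123830, 9575440247660, 1558694450905, 3117384707507,
    6234769415014, 12469534635725, 7346883227035, 14693766454070, 11795346863725,
    5998507683035, 11997011171767, 6401840493422, 12803676792541, 8015171734970,
    16030339275637, 12015629607575, 6439077365038, 12878150535773, 8164119221434,
    16328234248565, 15064286647018, 12536387249621, 7480588454827, 14961176909654,
    12330167774893, 7068153699674, 14136307399348, 10680432948584, 3768679852753,
    7537359705506, 15074715216709, 12557248583306, 7522315316500, 15044626438697,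
    12497071027282, 7401956010149, 14803907825995]

/-- The first six columns of the matrix `R`, as binary numbers. -/
def colsHead : List ℕ := [
    14468493588077, 11344801131739, 5097420413366, 10194836632429, 2797491414746,
    5594978635189]

/-- The remaining columns of the matrix `R`, as binary numbers. -/
def colsTail : List ℕ := [
    11189953076075, 4787720107735, 9575440215470, 1558694386525, 3117384578747,
    6234769157494, 12469534120685, 7346882196955, 14693764393910, 11795346937708,
    5998507831001, 11997011467699, 6401841085286, 12803677976269, 8015169908123,
    16030339816246, 7480672625303, 14961345250606, 12330504456797, 7068827063482,
    14137649932661, 10683118015210, 3774049986005, 7548095777707, 15096191555414,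
    12600197066413, 7608212282714, 15216424565428, 12840667280744, 8089148517073,
    16178297034146, 14764408023877, 11936634197642, 6281086545172, 12562168896041,
    7532155941970, 15064307689637, 12536429334859]

theorem count_rows_one : count rowsHead rowsTail 1 = 0 := by decide +kernel

theorem count_rows_two : count rowsHead rowsTail 2 = 22 := by decide +kernel

theorem count_rows_three : count rowsHead rowsTail 3 = 0 := by decide +kernel

theorem count_rows_four : count rowsHead rowsTail 4 = 33 := by decide +kernel

theorem count_rows_five : count rowsHead rowsTail 5 = 44 := by decide +kernel

theorem count_rows_six : count rowsHead rowsTail 6 = 88 := by decide +kernel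

theorem count_rows_seven : count rowsHead rowsTail 7 = 0 := by decide +kernel

theorem count_cols_one : count colsHead colsTail 1 = 0 := by decide +kernel

theorem count_cols_two : count colsHead colsTail 2 = 0 := by decide +kernel

theorem count_cols_three : count colsHead colsTail 3 = 0 := by decide +kernel

theorem count_cols_four : count colsHead colsTail 4 = 77 := by decide +kernel

theorem count_cols_five : count colsHead colsTail 5 = 0 := by decide +kernel

theorem count_cols_six : count colsHead colsTail 6 = 88 := by decide +kernel

end FourCirculant

section weights

theorem wt_cons {n : ℕ} (a : ZMod 2) (x : Fin n → ZMod 2) :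
    wt (Fin.cons a x : Fin (n + 1) → ZMod 2) = (if a ≠ 0 then 1 else 0) + wt x := by
  rw [wt, wt, Finset.card_filter, Finset.card_filter, Fin.sum_univ_succ]
  simp

end weights

namespace BitSlice

/-- The exclusive-or sum of the words `r i` with `x i ≠ 0`. -/
def xorSum : {n : ℕ} → (Fin n → ℕ) → (Fin n → ZMod 2) → ℕ
  | 0, _, _ => 0
  | _ + 1, r, x => (if x 0 = 0 then 0 else r 0) ^^^ xorSum (Fin.tail r) (Fin.tail x)

theorem card_xorSum {n : ℕ} (r : Fin n → ℕ) (k : ℕ) (p : ℕ → Prop) [DecidablePred p] :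
    (Finset.univ.filter fun x : Fin n → ZMod 2 => wt x = k ∧ p (xorSum r x)).card =
      (combos (List.ofFn r) k).countP (fun w => p w) := by
  induction n generalizing k p with
  | zero =>
    rw [Finset.card_filter, Fintype.sum_unique, List.ofFn_zero]
    have h0 : ∀ x : Fin 0 → ZMod 2, wt x = 0 := fun x => by simp [wt]
    cases k with
    | zero => simp [combos, xorSum, h0, List.countP_cons]
    | succ k => simp [combos, h0]
  | succ n ih =>
    have h := ih (Fin.tail r)
    rw [Finset.card_filter, ← (Fin.consEquiv fun _ => ZMod 2).sum_comp, Fintype.sum_prod_type]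
    change ∑ a : Fin 2, _ = _
    rw [Fin.sum_univ_two, ← Finset.card_filter, ← Finset.card_filter, List.ofFn_succ]
    have e0 : ∀ x : Fin n → ZMod 2, Fin.consEquiv (fun _ => ZMod 2) ((0 : Fin 2), x) =
      (Fin.cons (0 : ZMod 2) x : Fin (n + 1) → ZMod 2) := fun _ => rfl
    have e1 : ∀ x : Fin n → ZMod 2, Fin.consEquiv (fun _ => ZMod 2) ((1 : Fin 2), x) =
      (Fin.cons (1 : ZMod 2) x : Fin (n + 1) → ZMod 2) := fun _ => rfl
    simp only [e0, e1, wt_cons, xorSum, Fin.cons_zero, Fin.tail_cons, ne_eq, not_true_eq_false,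
      if_false, if_true, Nat.zero_xor, zero_add, one_ne_zero, not_false_eq_true]
    rw [h]
    cases k with
    | zero => simp [combos_zero]
    | succ k =>
      simp only [add_comm 1, add_left_inj]
      rw [h k fun w => p (r 0 ^^^ w), combos, List.countP_append, List.countP_map]
      rfl

/-- The binary digit number `j` of `w`, in `ZMod 2`. -/
def bitZ (w j : ℕ) : ZMod 2 := if w.testBit j then 1 else 0

theorem bitZ_xor (a b j : ℕ) : bitZ (a ^^^ b) j = bitZ a j + bitZ b j := by
  rw [bitZ, bitZ, bitZ, Nat.testBit_xor]
  cases a.testBit j <;> cases b.testBit j <;> decide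

theorem bitZ_and (a b j : ℕ) : bitZ (a &&& b) j = bitZ a j * bitZ b j := by
  rw [bitZ, bitZ, bitZ, Nat.testBit_and]
  cases a.testBit j <;> cases b.testBit j <;> decide

theorem bitZ_xorSum {n : ℕ} (r : Fin n → ℕ) (x : Fin n → ZMod 2) (j : ℕ) :
    bitZ (xorSum r x) j = ∑ i, x i * bitZ (r i) j := by
  induction n with
  | zero => simp [xorSum, bitZ]
  | succ n ih =>
    rw [xorSum, bitZ_xor, ih, Fin.sum_univ_succ]
    congr 1
    have : ∀ a : ZMod 2, a = 0 ∨ a = 1 := by decide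
    rcases this (x 0) with h | h <;> simp [h, bitZ]

theorem pop_eq_sum (w : ℕ) : pop w = ∑ j : Fin 44, (w.testBit j).toNat := by
  rw [pop, ← List.range_eq_range', Fin.sum_univ_eq_sum_range fun j => (w.testBit j).toNat]
  rfl

theorem pop_eq_wt (w : ℕ) : pop w = wt fun j : Fin 44 => bitZ w j := by
  rw [pop_eq_sum, wt, Finset.card_filter]
  refine Finset.sum_congr rfl fun j _ => ?_
  cases h : w.testBit j <;> simp [bitZ, h]

theorem cast_pop_and (a b : ℕ) :
    ((pop (a &&& b) : ℕ) : ZMod 2) = ∑ j : Fin 44, bitZ a j * bitZ b j := by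
  rw [pop_eq_sum, Nat.cast_sum]
  refine Finset.sum_congr rfl fun j _ => ?_
  rw [← bitZ_and]
  cases h : (a &&& b).testBit j <;> simp [bitZ, h]

/-- The binary matrix whose rows are the given words. -/
def mat (l : List ℕ) : Matrix (Fin 44) (Fin 44) (ZMod 2) :=
  Matrix.of fun i j => bitZ (l.getD i 0) j

theorem card_vecMul_mat (l : List ℕ) (hl : l.length = 44) (k : ℕ) (p : ℕ → Prop)
    [DecidablePred p] :
    (Finset.univ.filter fun x : Fin 44 → ZMod 2 => wt x = k ∧ p (wt (Matrix.vecMul x (mat l)))).card =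
      (combos l k).countP (fun w => p (pop w)) := by
  have hofFn : List.ofFn (fun i : Fin 44 => l.getD i 0) = l := by
    apply List.ext_getElem (by simp [hl])
    intro i h _
    rw [List.length_ofFn] at h
    rw [List.getElem_ofFn, List.getD_eq_getElem]
  have key := card_xorSum (fun i : Fin 44 => l.getD i 0) k fun w => p (pop w)
  rw [hofFn] at key
  rw [← key]
  refine congrArg Finset.card (Finset.ext fun x => ?_)
  have : (fun j : Fin 44 => bitZ (xorSum (fun i : Fin 44 => l.getD i 0) x) j) =
      Matrix.vecMul x (mat l) := by
    ext j; rw [bitZ_xorSum]; rfl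
  simp only [Finset.mem_filter, Finset.mem_univ, true_and, pop_eq_wt, this]

variable {out base : List ℕ} {i N : ℕ}

theorem bounds_of_count (h : count out base i = N) (hN : N < 2 ^ 20)
    (hi : i ≤ 7) (ho : out.length = 6) (hb : base.length = 38) :
    (∀ x : Fin 44 → ZMod 2, wt x = i → 16 - i ≤ wt (Matrix.vecMul x (mat (out ++ base))) ∧
      wt (Matrix.vecMul x (mat (out ++ base))) ≤ 32 + i) ∧
    (Finset.univ.filter fun x : Fin 44 → ZMod 2 => wt x = i ∧
      wt (Matrix.vecMul x (mat (out ++ base))) = 32 + i).card = N := by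
  have hl : (out ++ base).length = 44 := by simp [ho, hb]
  have hchoose : ∀ k ≤ i, base.length.choose k ≤ 2 ^ 24 := by
    intro k hk
    have hk' : k ≤ 7 := hk.trans hi
    rw [hb]
    rw [Nat.choose_eq_descFactorial_div_factorial]
    interval_cases k <;> decide +kernel
  rw [count_eq out base i hi hchoose] at h
  have h0 : (combos (out ++ base) i).countP (fun w => pop w < 16 - i ∨ 33 + i ≤ pop w) = 0 := by
    omega
  rw [h0, mul_zero, add_zero, ← card_vecMul_mat _ hl i fun w => 32 + i ≤ w] at h
  rw [← card_vecMul_mat _ hl i fun w => w < 16 - i ∨ 33 + i ≤ w, Finset.card_eq_zero,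
    Finset.filter_eq_empty_iff] at h0
  have hbound : ∀ x : Fin 44 → ZMod 2, wt x = i → 16 - i ≤ wt (Matrix.vecMul x (mat (out ++ base))) ∧
      wt (Matrix.vecMul x (mat (out ++ base))) ≤ 32 + i := by
    intro x hx
    have h1 : ¬(wt x = i ∧ _) := @h0 x (by simp)
    rw [not_and] at h1
    have := h1 hx
    omega
  refine ⟨hbound, ?_⟩
  rw [← h]
  refine congrArg Finset.card (Finset.filter_congr fun x _ => and_congr_right fun hx => ?_)
  exact ⟨fun h => h.ge, fun h => le_antisymm (hbound x hx).2 h⟩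

end BitSlice

section macWilliams

open Polynomial

variable {ι : Type*} [Fintype ι]

/-- The nontrivial character of `ZMod 2`. -/
def sgn (a : ZMod 2) : ℤ := if a = 0 then 1 else -1

theorem sgn_add (a b : ZMod 2) : sgn (a + b) = sgn a * sgn b := by
  revert a b; decide

theorem sgn_sum {κ : Type*} (s : Finset κ) (f : κ → ZMod 2) :
    sgn (∑ i ∈ s, f i) = ∏ i ∈ s, sgn (f i) := by
  classical
  induction s using Finset.induction_on with
  | empty => rfl
  | insert a s ha ih => rw [Finset.sum_insert ha, Finset.prod_insert ha, sgn_add, ih]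

open Classical in
theorem sum_sgn_dotProduct (C : Submodule (ZMod 2) (ι → ZMod 2)) (v : ι → ZMod 2) :
    ∑ c : C, sgn (∑ i, v i * c.1 i) = if v ∈ dualCode C then (Fintype.card C : ℤ) else 0 := by
  split_ifs with h
  · have : ∀ c : C, sgn (∑ i, v i * c.1 i) = 1 := fun c => by rw [h c.1 c.2]; rfl
    simp [this]
  · have : ∃ c ∈ C, ∑ i, v i * c i ≠ 0 := by
      by_contra! hc
      exact h hc
    obtain ⟨d, hd, hne⟩ := this
    have hshift : ∑ c : C, sgn (∑ i, v i * c.1 i) = ∑ c : C, -sgn (∑ i, v i * c.1 i) := by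
      rw [← Equiv.sum_comp (Equiv.addLeft (⟨d, hd⟩ : C))]
      refine Finset.sum_congr rfl fun c _ => ?_
      have : ∑ i, v i * (Equiv.addLeft (⟨d, hd⟩ : C) c).1 i =
          ∑ i, v i * d i + ∑ i, v i * c.1 i := by
        simp [mul_add, Finset.sum_add_distrib]
      rw [this, sgn_add, sgn, if_neg hne, neg_one_mul]
    rw [Finset.sum_neg_distrib] at hshift
    linarith

/-- The value at `w` of the Krawtchouk polynomial of degree `j` for length `n`. -/
noncomputable def krawtchouk (n w j : ℕ) : ℤ := ((1 + X : ℤ[X]) ^ (n - w) * (1 - X) ^ w).coeff j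

theorem sum_sgn_X_pow_wt [DecidableEq ι] (c : ι → ZMod 2) :
    ∑ v : ι → ZMod 2, C (sgn (∑ i, v i * c i)) * (X : ℤ[X]) ^ wt v =
      (1 + X) ^ (Fintype.card ι - wt c) * (1 - X) ^ wt c := by
  have h1 : ∀ v : ι → ZMod 2, C (sgn (∑ i, v i * c i)) * (X : ℤ[X]) ^ wt v =
      ∏ i, (C (sgn (v i * c i)) * if v i ≠ 0 then (X : ℤ[X]) else 1) := by
    intro v
    rw [Finset.prod_mul_distrib, ← map_prod, ← sgn_sum, Finset.prod_ite, Finset.prod_const,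
      Finset.prod_const_one, mul_one, wt]
  have h2 : ∀ a : ZMod 2, ∑ b : ZMod 2, (C (sgn (b * a)) * if b ≠ 0 then (X : ℤ[X]) else 1) =
      if a ≠ 0 then 1 - X else 1 + X := by
    intro a
    rw [show (Finset.univ : Finset (ZMod 2)) = {0, 1} by decide, Finset.sum_pair zero_ne_one]
    have ha : a = 0 ∨ a = 1 := by revert a; decide
    rcases ha with rfl | rfl
    · simp [sgn]
    · simp [sgn, sub_eq_add_neg]
  simp only [h1]
  rw [← Fintype.prod_sum fun i (b : ZMod 2) => C (sgn (b * c i)) * if b ≠ 0 then (X : ℤ[X]) else 1]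
  simp only [h2]
  rw [Finset.prod_ite, Finset.prod_const, Finset.prod_const, mul_comm, ← wt]
  congr 2
  rw [Finset.filter_not, Finset.card_sdiff_of_subset (Finset.subset_univ _), Finset.card_univ, wt]

theorem sum_sgn_of_wt_eq [DecidableEq ι] (c : ι → ZMod 2) (j : ℕ) :
    ∑ v : ι → ZMod 2 with wt v = j, sgn (∑ i, v i * c i) =
      krawtchouk (Fintype.card ι) (wt c) j := by
  rw [krawtchouk, ← sum_sgn_X_pow_wt, finsetSum_coeff, Finset.sum_filter]
  refine Finset.sum_congr rfl fun v _ => ?_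
  rw [coeff_C_mul, coeff_X_pow]
  simp [eq_comm]

open Classical in
/-- The MacWilliams identity for the subcode of `C` of words `c` with `∑ i, s i * c i = 0`. -/
theorem two_mul_sum_krawtchouk (C : Submodule (ZMod 2) (ι → ZMod 2)) (s : ι → ZMod 2) (j : ℕ) :
    2 * ∑ c : C with ∑ i, s i * c.1 i = 0, krawtchouk (Fintype.card ι) (wt c.1) j =
      Fintype.card C * ((Finset.univ.filter fun v => wt v = j ∧ v ∈ dualCode C).card +
        (Finset.univ.filter fun v => wt v = j ∧ v + s ∈ dualCode C).card) := by
  have hL : 2 * ∑ c : C with ∑ i, s i * c.1 i = 0, krawtchouk (Fintype.card ι) (wt c.1) j =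
      ∑ c : C, (1 + sgn (∑ i, s i * c.1 i)) * krawtchouk (Fintype.card ι) (wt c.1) j := by
    rw [Finset.sum_filter, Finset.mul_sum]
    refine Finset.sum_congr rfl fun c _ => ?_
    by_cases h : ∑ i, s i * c.1 i = 0 <;> simp [h, sgn]
  have hR : ∀ c : C, (1 + sgn (∑ i, s i * c.1 i)) * krawtchouk (Fintype.card ι) (wt c.1) j =
      ∑ v : ι → ZMod 2 with wt v = j,
        (sgn (∑ i, v i * c.1 i) + sgn (∑ i, (v + s) i * c.1 i)) := by
    intro c
    rw [← sum_sgn_of_wt_eq, Finset.mul_sum]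
    refine Finset.sum_congr rfl fun v _ => ?_
    have : ∑ i, (v + s) i * c.1 i = ∑ i, v i * c.1 i + ∑ i, s i * c.1 i := by
      simp [add_mul, Finset.sum_add_distrib]
    rw [this, sgn_add]
    ring
  rw [hL, Finset.sum_congr rfl fun c _ => hR c, Finset.sum_comm]
  simp only [Finset.sum_add_distrib, sum_sgn_dotProduct]
  rw [← Finset.sum_filter, ← Finset.sum_filter, Finset.filter_filter, Finset.filter_filter,
    Finset.sum_const, Finset.sum_const, nsmul_eq_mul, nsmul_eq_mul]
  ring

end macWilliams

section krawtchouk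

open Polynomial

theorem krawtchouk_eq_sum (n w j : ℕ) :
    krawtchouk n w j = ∑ k ∈ Finset.range (j + 1),
      ((n - w).descFactorial k / k.factorial : ℕ) *
        ((-1) ^ (j - k) * (w.descFactorial (j - k) / (j - k).factorial : ℕ) : ℤ) := by
  have h : ∀ k, ((1 - X : ℤ[X]) ^ w).coeff k = (-1) ^ k * (w.choose k : ℤ) := by
    intro k
    rw [show (1 - X : ℤ[X]) = C (-1) * (X + C (-1)) by rw [C_neg, C_1]; ring, mul_pow, ← C_pow,
      coeff_C_mul, coeff_X_add_C_pow]
    rcases le_or_gt k w with hk | hk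
    · obtain ⟨m, rfl⟩ := Nat.exists_eq_add_of_le hk
      rw [Nat.add_sub_cancel_left, ← mul_assoc, ← pow_add, add_assoc, pow_add, ← two_mul,
        pow_mul, neg_one_sq, one_pow, mul_one]
    · simp [Nat.choose_eq_zero_of_lt hk]
  rw [krawtchouk, coeff_mul, Finset.Nat.sum_antidiagonal_eq_sum_range_succ_mk]
  refine Finset.sum_congr rfl fun k _ => ?_
  rw [coeff_one_add_X_pow, h, Nat.choose_eq_descFactorial_div_factorial,
    Nat.choose_eq_descFactorial_div_factorial]

/-- Coefficients of a combination of Krawtchouk polynomials for length 88 that vanishes at 88 and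
at the multiples of 4 from 20 to 72. -/
def krawCoeff (j : ℕ) : ℤ :=
  [430848, 261256, 150144, 97512, 65280, 37048, 18816, 10904, 6912, 3595, 1488, 671, 384, 177, 48,
    5].getD j 0

theorem sum_krawCoeff_zero :
    ∑ j ∈ Finset.range 16, krawCoeff j * krawtchouk 88 0 j = 789537309673390080 := by
  simp only [krawtchouk_eq_sum]
  decide +kernel

theorem sum_krawCoeff_sixteen :
    ∑ j ∈ Finset.range 16, krawCoeff j * krawtchouk 88 16 j = 211106232532992 := by
  simp only [krawtchouk_eq_sum]
  decide +kernel

theorem sum_krawCoeff_eq_zero {w : ℕ} (h4 : 4 ∣ w) (h : 20 ≤ w ∧ w ≤ 72 ∨ w = 88) :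
    ∑ j ∈ Finset.range 16, krawCoeff j * krawtchouk 88 w j = 0 := by
  simp only [krawtchouk_eq_sum]
  obtain ⟨m, rfl⟩ := h4
  have key : ∀ m < 23, 5 ≤ m ∧ m ≤ 18 ∨ m = 22 → ∑ j ∈ Finset.range 16, krawCoeff j *
      ∑ k ∈ Finset.range (j + 1), ((88 - 4 * m).descFactorial k / k.factorial : ℕ) *
        ((-1) ^ (j - k) * ((4 * m).descFactorial (j - k) / (j - k).factorial : ℕ) : ℤ) = 0 := by
    decide +kernel
  exact key m (by omega) (by omega)

end krawtchouk

section selfDual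

variable {ι : Type*} [Fintype ι]

theorem wt_eq_zero {x : ι → ZMod 2} : wt x = 0 ↔ x = 0 := by
  simp [wt, Finset.filter_eq_empty_iff, funext_iff]

theorem wt_zero : wt (0 : ι → ZMod 2) = 0 := wt_eq_zero.2 rfl

theorem wt_le (x : ι → ZMod 2) : wt x ≤ Fintype.card ι := Finset.card_le_univ _

theorem wt_add_one (x : ι → ZMod 2) : wt (x + 1) = Fintype.card ι - wt x := by
  classical
  rw [wt, wt, ← Finset.card_univ, ← Finset.card_sdiff_of_subset (Finset.subset_univ _),
    ← Finset.filter_not]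
  refine congrArg Finset.card (Finset.filter_congr fun i _ => ?_)
  have : ∀ a : ZMod 2, a + 1 ≠ 0 ↔ ¬a ≠ 0 := by decide
  exact this (x i)

theorem natCast_wt (x : ι → ZMod 2) : (wt x : ZMod 2) = ∑ i, x i * x i := by
  rw [wt, Finset.card_filter, Nat.cast_sum]
  refine Finset.sum_congr rfl fun i _ => ?_
  have : ∀ a : ZMod 2, ((if a ≠ 0 then 1 else 0 : ℕ) : ZMod 2) = a * a := by decide
  exact this (x i)

theorem wt_add_add (x y : ι → ZMod 2) : wt (x + y) + 2 * wt (x * y) = wt x + wt y := by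
  simp only [wt, Finset.card_filter, Finset.mul_sum, ← Finset.sum_add_distrib]
  refine Finset.sum_congr rfl fun i _ => ?_
  have : ∀ a b : ZMod 2, (if a + b ≠ 0 then 1 else 0) + 2 * (if a * b ≠ 0 then 1 else 0) =
      (if a ≠ 0 then 1 else 0) + (if b ≠ 0 then 1 else 0) := by decide
  exact this (x i) (y i)

variable {C : Submodule (ZMod 2) (ι → ZMod 2)}

theorem IsSelfDual.mem_iff (hC : IsSelfDual C) {x : ι → ZMod 2} :
    x ∈ C ↔ ∀ c ∈ C, ∑ i, x i * c i = 0 := by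
  conv_lhs => rw [hC]
  exact Iff.rfl

theorem IsSelfDual.isEvenCode (hC : IsSelfDual C) : IsEvenCode C := by
  intro c hc
  rw [← ZMod.natCast_eq_zero_iff, natCast_wt]
  exact hC.mem_iff.1 hc c hc

theorem IsSelfDual.one_mem (hC : IsSelfDual C) : (1 : ι → ZMod 2) ∈ C := by
  refine hC.mem_iff.2 fun c hc => ?_
  rw [← hC.mem_iff.1 hc c hc]
  refine Finset.sum_congr rfl fun i _ => ?_
  have : ∀ a : ZMod 2, 1 * a = a * a := by decide
  exact this (c i)

open Classical in
theorem Awt_eq_card (C : Submodule (ZMod 2) (ι → ZMod 2)) (j : ℕ) :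
    Awt C j = (Finset.univ.filter fun v => wt v = j ∧ v ∈ C).card := by
  rw [Awt, ← Set.ncard_coe_finset]
  congr 1
  ext v
  simp [and_comm]

theorem Awt_zero (C : Submodule (ZMod 2) (ι → ZMod 2)) : Awt C 0 = 1 := by
  classical
  rw [Awt_eq_card, Finset.card_eq_one]
  refine ⟨0, ?_⟩
  ext v
  simp only [Finset.mem_filter, Finset.mem_univ, true_and, Finset.mem_singleton, wt_eq_zero]
  constructor
  · exact fun h => h.1
  · rintro rfl; exact ⟨rfl, C.zero_mem⟩

theorem Awt_eq_zero {d : ℕ} (hmin : ∀ c ∈ C, c ≠ 0 → d ≤ wt c) {j : ℕ} (h0 : j ≠ 0)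
    (hj : j < d) : Awt C j = 0 := by
  classical
  rw [Awt_eq_card, Finset.card_eq_zero, Finset.filter_eq_empty_iff]
  rintro v - ⟨rfl, hv⟩
  have := hmin v hv fun h => h0 (wt_eq_zero.2 h)
  omega

theorem wt_mem_of_four_dvd (hι : Fintype.card ι = 88) (hC : IsSelfDual C)
    (hmin : ∀ c ∈ C, c ≠ 0 → 16 ≤ wt c) {c : ι → ZMod 2} (hc : c ∈ C) (h4 : 4 ∣ wt c) :
    wt c = 0 ∨ wt c = 16 ∨ (20 ≤ wt c ∧ wt c ≤ 72 ∨ wt c = 88) := by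
  have h0 : wt c = 0 ∨ 16 ≤ wt c := by
    by_cases h : c = 0
    · exact Or.inl (wt_eq_zero.2 h)
    · exact Or.inr (hmin c hc h)
  have h1 : wt (c + 1) = 0 ∨ 16 ≤ wt (c + 1) := by
    by_cases h : c + 1 = 0
    · exact Or.inl (wt_eq_zero.2 h)
    · exact Or.inr (hmin _ (C.add_mem hc hC.one_mem) h)
  have := wt_le c
  rw [wt_add_one] at h1
  omega

theorem ncard_eq_card_filter {α : Type*} [Fintype α] (p : α → Prop) [DecidablePred p] :
    Set.ncard {v | p v} = (Finset.univ.filter p).card := by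
  rw [← Set.ncard_coe_finset, Finset.coe_filter_univ]

/-- The number of vectors of weight 16 of a self-dual code of length 88 and minimum weight at least
16, in terms of the vectors `v` of weight less than 16 with `v + s ∈ C`, where the words of `C`
orthogonal to `s` are those of weight divisible by 4. -/
theorem Awt_sixteen_identity (hι : Fintype.card ι = 88) (hC : IsSelfDual C)
    (hk : Module.finrank (ZMod 2) C = 44) (hmin : ∀ c ∈ C, c ≠ 0 → 16 ≤ wt c)
    (s : ι → ZMod 2) (hs : ∀ c ∈ C, ∑ i, s i * c i = 0 ↔ 4 ∣ wt c) :
    2 * (789537309673390080 + 211106232532992 * (Awt C 16 : ℤ)) =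
      2 ^ 44 * (krawCoeff 0 + ∑ j ∈ Finset.range 16,
        krawCoeff j * Set.ncard {v | wt v = j ∧ v + s ∈ C}) := by
  classical
  simp only [ncard_eq_card_filter fun v => wt v = _ ∧ v + s ∈ C]
  have hcard : (Fintype.card C : ℤ) = 2 ^ 44 := by
    rw [Module.card_eq_pow_finrank (K := ZMod 2), hk, ZMod.card]; norm_num
  have hA : ∀ j ∈ Finset.range 16,
      krawCoeff j * (Finset.univ.filter fun v => wt v = j ∧ v ∈ C).card =
        if j = 0 then krawCoeff 0 else 0 := by
    intro j hj
    rw [← Awt_eq_card]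
    split_ifs with h
    · rw [h, Awt_zero]; simp
    · rw [Awt_eq_zero hmin h (Finset.mem_range.1 hj)]; simp
  have hsum : ∑ j ∈ Finset.range 16, krawCoeff j *
      (2 * ∑ c : C with ∑ i, s i * c.1 i = 0, krawtchouk 88 (wt c.1) j) =
      2 ^ 44 * (krawCoeff 0 + ∑ j ∈ Finset.range 16,
        krawCoeff j * (Finset.univ.filter fun v => wt v = j ∧ v + s ∈ C).card) := by
    have h1 : ∀ j ∈ Finset.range 16, krawCoeff j *
        (2 * ∑ c : C with ∑ i, s i * c.1 i = 0, krawtchouk 88 (wt c.1) j) =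
        2 ^ 44 * (krawCoeff j * (Finset.univ.filter fun v => wt v = j ∧ v ∈ C).card) +
        2 ^ 44 * (krawCoeff j * (Finset.univ.filter fun v => wt v = j ∧ v + s ∈ C).card) := by
      intro j _
      have := two_mul_sum_krawtchouk C s j
      rw [hι, ← hC, hcard] at this
      rw [this]
      ring
    rw [Finset.sum_congr rfl h1, Finset.sum_add_distrib, ← Finset.mul_sum, ← Finset.mul_sum,
      Finset.sum_congr rfl hA, Finset.sum_ite_eq' (Finset.range 16) 0 fun _ => krawCoeff 0,
      if_pos (by simp), mul_add]
  rw [← hsum]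
  have htwo : ∀ f g : ℕ → ℤ, ∑ j ∈ Finset.range 16, f j * (2 * g j) =
      2 * ∑ j ∈ Finset.range 16, f j * g j := fun f g => by
    rw [Finset.mul_sum]; exact Finset.sum_congr rfl fun _ _ => mul_left_comm _ _ _
  rw [htwo]
  congr 1
  simp only [Finset.mul_sum]
  rw [Finset.sum_comm]
  have h2 : ∀ c ∈ Finset.univ.filter (fun c : C => ∑ i, s i * c.1 i = 0),
      ∑ j ∈ Finset.range 16, krawCoeff j * krawtchouk 88 (wt c.1) j =
        (if wt c.1 = 0 then 789537309673390080 else 0) +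
          if wt c.1 = 16 then 211106232532992 else 0 := by
    intro c hc
    have h4 := (hs c c.2).1 (Finset.mem_filter.1 hc).2
    rcases wt_mem_of_four_dvd hι hC hmin c.2 h4 with h | h | h
    · rw [h, sum_krawCoeff_zero]; norm_num
    · rw [h, sum_krawCoeff_sixteen]; norm_num
    · rw [sum_krawCoeff_eq_zero h4 h, if_neg (by omega), if_neg (by omega), add_zero]
  have h3 : ∀ j, 4 ∣ j → ∀ a : ℤ, (∑ c : C with ∑ i, s i * c.1 i = 0,
      if wt c.1 = j then a else 0) = a * Awt C j := by
    intro j hj a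
    rw [Finset.sum_filter,
      ← Finset.sum_subtype (Finset.univ.filter (· ∈ C)) (by simp)
        fun c => if ∑ i, s i * c i = 0 then if wt c = j then a else 0 else 0,
      Finset.sum_filter, Awt_eq_card, Finset.card_filter, Nat.cast_sum, Finset.mul_sum]
    refine Finset.sum_congr rfl fun c _ => ?_
    by_cases hc : c ∈ C
    · by_cases hj' : wt c = j
      · simp [hc, hj', (hs c hc).2 (hj' ▸ hj)]
      · simp [hj']
    · simp [hc]
  rw [Finset.sum_congr rfl h2, Finset.sum_add_distrib, h3 0 (by norm_num), h3 16 (by norm_num),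
    Awt_zero]
  norm_num

end selfDual

section doublyEven

theorem Awt_sixteen_of_doublyEven {ι : Type*} [Fintype ι] {C : Submodule (ZMod 2) (ι → ZMod 2)}
    (hι : Fintype.card ι = 88) (hC : IsSelfDual C) (hk : Module.finrank (ZMod 2) C = 44)
    (hmin : ∀ c ∈ C, c ≠ 0 → 16 ≤ wt c) (h4 : ∀ c ∈ C, 4 ∣ wt c) : Awt C 16 = 32164 := by
  classical
  have h := Awt_sixteen_identity hι hC hk hmin 0 fun c hc => by simpa using h4 c hc
  simp only [add_zero, ncard_eq_card_filter, ← Awt_eq_card] at h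
  rw [Finset.sum_eq_single_of_mem 0 (by simp) fun j hj h0 => by
    rw [Awt_eq_zero hmin h0 (Finset.mem_range.1 hj)]; simp, Awt_zero,
    show krawCoeff 0 = 430848 from rfl] at h
  push_cast at h
  omega

end doublyEven

section systematic

open Matrix

theorem natCast_wt_mul {ι : Type*} [Fintype ι] (x y : ι → ZMod 2) :
    (wt (x * y) : ZMod 2) = ∑ i, x i * y i := by
  rw [natCast_wt]
  refine Finset.sum_congr rfl fun i _ => ?_
  have : ∀ a b : ZMod 2, a * b * (a * b) = a * b := by decide
  exact this (x i) (y i)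

variable {n : ℕ} (R : Matrix (Fin n) (Fin n) (ZMod 2))

theorem wt_append {m n : ℕ} (x : Fin m → ZMod 2) (y : Fin n → ZMod 2) :
    wt (Fin.append x y) = wt x + wt y := by
  simp only [wt, Finset.card_filter, Fin.sum_univ_add, Fin.append_left, Fin.append_right]

theorem sum_append_mul_append {m n : ℕ} (x x' : Fin m → ZMod 2) (y y' : Fin n → ZMod 2) :
    ∑ i, Fin.append x y i * Fin.append x' y' i = x ⬝ᵥ x' + y ⬝ᵥ y' := by
  simp only [Fin.sum_univ_add, Fin.append_left, Fin.append_right, dotProduct]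

theorem append_add_append {m n : ℕ} (x x' : Fin m → ZMod 2) (y y' : Fin n → ZMod 2) :
    Fin.append x y + Fin.append x' y' = Fin.append (x + x') (y + y') := by
  ext i
  refine Fin.addCases (fun i => ?_) (fun i => ?_) i <;> simp

theorem smul_append {m n : ℕ} (a : ZMod 2) (x : Fin m → ZMod 2) (y : Fin n → ZMod 2) :
    a • Fin.append x y = Fin.append (a • x) (a • y) := by
  ext i
  refine Fin.addCases (fun i => ?_) (fun i => ?_) i <;> simp

theorem append_self_apply {m n : ℕ} (a : ZMod 2) :
    Fin.append (fun _ : Fin m => a) (fun _ : Fin n => a) = fun _ => a := by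
  ext i
  refine Fin.addCases (fun i => ?_) (fun i => ?_) i <;> simp

theorem append_inj {m n : ℕ} {x x' : Fin m → ZMod 2} {y y' : Fin n → ZMod 2} :
    Fin.append x y = Fin.append x' y' ↔ x = x' ∧ y = y' := by
  constructor
  · intro h
    constructor <;> ext i
    · simpa using congrFun h (Fin.castAdd n i)
    · simpa using congrFun h (Fin.natAdd m i)
  · rintro ⟨rfl, rfl⟩
    rfl

theorem exists_eq_append {m n : ℕ} (v : Fin (m + n) → ZMod 2) :
    ∃ x y, v = Fin.append x y :=
  ⟨_, _, (Fin.append_castAdd_natAdd (f := v)).symm⟩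

/-- The code generated by `(I | R)`. -/
def sysCode : Submodule (ZMod 2) (Fin (n + n) → ZMod 2) where
  carrier := {v | ∃ x, v = Fin.append x (x ᵥ* R)}
  zero_mem' := ⟨0, by rw [zero_vecMul]; exact (append_self_apply 0).symm⟩
  add_mem' := by
    rintro _ _ ⟨x, rfl⟩ ⟨y, rfl⟩
    exact ⟨x + y, by rw [append_add_append, add_vecMul]⟩
  smul_mem' := by
    rintro a _ ⟨x, rfl⟩
    exact ⟨a • x, by rw [smul_append, smul_vecMul]⟩

variable {R}

theorem append_mem_sysCode {x y : Fin n → ZMod 2} :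
    Fin.append x y ∈ sysCode R ↔ y = x ᵥ* R := by
  constructor
  · rintro ⟨x', h⟩
    obtain ⟨rfl, rfl⟩ := append_inj.1 h
    rfl
  · rintro rfl
    exact ⟨x, rfl⟩

theorem finrank_sysCode : Module.finrank (ZMod 2) (sysCode R) = n := by
  let f : (Fin n → ZMod 2) →ₗ[ZMod 2] sysCode R :=
    { toFun := fun x => ⟨Fin.append x (x ᵥ* R), append_mem_sysCode.2 rfl⟩
      map_add' := fun x y => Subtype.ext (by
        change Fin.append (x + y) ((x + y) ᵥ* R) = _
        rw [add_vecMul]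
        exact (append_add_append _ _ _ _).symm)
      map_smul' := fun a x => Subtype.ext (by
        change Fin.append (a • x) ((a • x) ᵥ* R) = _
        rw [smul_vecMul]
        exact (smul_append _ _ _).symm) }
  have hf : Function.Bijective f := by
    constructor
    · intro x y h
      exact (append_inj.1 (congrArg Subtype.val h)).1
    · rintro ⟨_, x, rfl⟩
      exact ⟨x, rfl⟩
  rw [← (LinearEquiv.ofBijective f hf).finrank_eq, Module.finrank_fin_fun]

theorem isSelfDual_sysCode (hR : R * Rᵀ = 1) : IsSelfDual (sysCode R) := by
  have hR' : Rᵀ * R = 1 := mul_eq_one_comm.1 hR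
  refine Submodule.ext fun v => ?_
  obtain ⟨x, y, rfl⟩ := exists_eq_append v
  rw [append_mem_sysCode]
  constructor
  · rintro rfl _ ⟨z, rfl⟩
    rw [sum_append_mul_append, ← mulVec_transpose R z, dotProduct_mulVec, vecMul_vecMul, hR,
      vecMul_one, CharTwo.add_self_eq_zero]
  · intro h
    have h1 : x + y ᵥ* Rᵀ = 0 := by
      refine dotProduct_eq_zero _ fun z => ?_
      have := h _ ⟨z, rfl⟩
      rwa [sum_append_mul_append, ← mulVec_transpose R z, dotProduct_mulVec,
        ← add_dotProduct] at this
    rw [show x = y ᵥ* Rᵀ from funext fun i => CharTwo.add_eq_zero.1 (congrFun h1 i), vecMul_vecMul, hR', vecMul_one]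

theorem one_vecMul_of_mul_transpose (hR : R * Rᵀ = 1) : (1 : Fin n → ZMod 2) ᵥ* R = 1 := by
  have h := (isSelfDual_sysCode hR).one_mem
  have h1 : (1 : Fin (n + n) → ZMod 2) = Fin.append 1 1 := (append_self_apply 1).symm
  rw [h1, append_mem_sysCode] at h
  exact h.symm

theorem wt_vecMul_mod_four (hR : R * Rᵀ = 1) (hrow : ∀ i, wt (R i) % 4 = 1) (x : Fin n → ZMod 2) :
    wt (x ᵥ* R) % 4 = wt x % 4 := by
  have hdot : ∀ x y : Fin n → ZMod 2, ∑ i, (x ᵥ* R) i * (y ᵥ* R) i = ∑ i, x i * y i := by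
    intro x y
    change (x ᵥ* R) ⬝ᵥ (y ᵥ* R) = x ⬝ᵥ y
    rw [← mulVec_transpose R y, dotProduct_mulVec, vecMul_vecMul, hR, vecMul_one]
  rw [← Finset.univ_sum_single x]
  refine Finset.sum_induction _ (fun x : Fin n → ZMod 2 => wt (x ᵥ* R) % 4 = wt x % 4)
    (fun x y hx hy => ?_) (by simp [wt_zero]) fun i _ => ?_
  · have h1 := wt_add_add x y
    have h2 := wt_add_add (x ᵥ* R) (y ᵥ* R)
    have h3 : wt ((x ᵥ* R) * (y ᵥ* R)) % 2 = wt (x * y) % 2 := by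
      refine (ZMod.natCast_eq_natCast_iff' _ _ 2).1 ?_
      rw [natCast_wt_mul, natCast_wt_mul, hdot]
    rw [add_vecMul]
    omega
  · have : x i = 0 ∨ x i = 1 := by generalize x i = a; revert a; decide
    rcases this with h | h
    · simp [h, wt_zero]
    · rw [h, single_one_vecMul]
      have : wt (Pi.single i 1 : Fin n → ZMod 2) = 1 := by
        rw [wt, Finset.card_eq_one]
        exact ⟨i, by ext j; simp [Pi.single_apply]⟩
      rw [this]
      exact hrow i

end systematic

section singlyEven

open Matrix

variable {n : ℕ} {R : Matrix (Fin n) (Fin n) (ZMod 2)}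

theorem vecMul_vecMul_transpose (hR : R * Rᵀ = 1) (x : Fin n → ZMod 2) : x ᵥ* R ᵥ* Rᵀ = x := by
  rw [vecMul_vecMul, hR, vecMul_one]

theorem vecMul_transpose_vecMul (hR : R * Rᵀ = 1) (x : Fin n → ZMod 2) : x ᵥ* Rᵀ ᵥ* R = x := by
  rw [vecMul_vecMul, mul_eq_one_comm.1 hR, vecMul_one]

theorem one_vecMul_transpose (hR : R * Rᵀ = 1) : (1 : Fin n → ZMod 2) ᵥ* Rᵀ = 1 := by
  conv_lhs => rw [← one_vecMul_of_mul_transpose hR, vecMul_vecMul_transpose hR]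

theorem add_one_add_one (x : Fin n → ZMod 2) : x + 1 + 1 = x := by
  ext i
  have : ∀ a : ZMod 2, a + 1 + 1 = a := by decide
  exact this (x i)

theorem complement_vecMul_transpose (hR : R * Rᵀ = 1) (x : Fin n → ZMod 2) :
    (x ᵥ* R + 1) ᵥ* Rᵀ + 1 = x := by
  rw [add_vecMul, vecMul_vecMul_transpose hR, one_vecMul_transpose hR, add_one_add_one]

theorem complement_transpose_vecMul (hR : R * Rᵀ = 1) (x : Fin n → ZMod 2) :
    (x ᵥ* Rᵀ + 1) ᵥ* R + 1 = x := by
  rw [add_vecMul, vecMul_transpose_vecMul hR, one_vecMul_of_mul_transpose hR, add_one_add_one]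

theorem wt_fin_add_one (hn : n = 44) (x : Fin n → ZMod 2) : wt (x + 1) + wt x = 44 := by
  have h := wt_le x
  rw [wt_add_one]
  rw [Fintype.card_fin] at h ⊢
  omega

theorem wt_pos {x : Fin n → ZMod 2} (hx : x ≠ 0) : 1 ≤ wt x :=
  Nat.one_le_iff_ne_zero.2 fun h => hx (wt_eq_zero.1 h)

theorem sixteen_le_wt_of_mem_sysCode (hR : R * Rᵀ = 1) (hrow : ∀ i, wt (R i) % 4 = 1)
    (hbR : ∀ x, 1 ≤ wt x → wt x ≤ 7 → 16 ≤ wt x + wt (x ᵥ* R) ∧ wt (x ᵥ* R) ≤ 32 + wt x)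
    (hbT : ∀ x, 1 ≤ wt x → wt x ≤ 6 → 16 ≤ wt x + wt (x ᵥ* Rᵀ) ∧ wt (x ᵥ* Rᵀ) ≤ 32 + wt x)
    {c : Fin (n + n) → ZMod 2} (hc : c ∈ sysCode R) (h0 : c ≠ 0) : 16 ≤ wt c := by
  obtain ⟨x, rfl⟩ := hc
  rw [wt_append]
  have hx : x ≠ 0 := by
    rintro rfl
    exact h0 (by rw [zero_vecMul]; exact append_self_apply 0)
  have hy : x ᵥ* R ≠ 0 := by
    intro h
    apply hx
    rw [← vecMul_vecMul_transpose hR x, h, zero_vecMul]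
  have h4 := wt_vecMul_mod_four hR hrow x
  have h1 := hbR x (wt_pos hx)
  have h2 := hbT _ (wt_pos hy)
  rw [vecMul_vecMul_transpose hR] at h2
  omega

theorem ncard_coset_eq (hR : R * Rᵀ = 1) (j : ℕ) :
    Set.ncard {v | wt v = j ∧ v + Fin.append 1 0 ∈ sysCode R} =
      (Finset.univ.filter fun x => wt x + wt (x ᵥ* R + 1) = j).card := by
  have key (x y : Fin n → ZMod 2) :
      Fin.append x y + Fin.append 1 0 ∈ sysCode R ↔ y = x ᵥ* R + 1 := by
    rw [append_add_append, append_mem_sysCode, add_zero, add_vecMul,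
      one_vecMul_of_mul_transpose hR]
  have himage : {v | wt v = j ∧ v + Fin.append 1 0 ∈ sysCode R} =
      (fun x => Fin.append x (x ᵥ* R + 1)) '' {x | wt x + wt (x ᵥ* R + 1) = j} := by
    ext v
    constructor
    · rintro ⟨h, hv⟩
      obtain ⟨x, y, rfl⟩ := exists_eq_append v
      rw [key] at hv
      subst hv
      rw [wt_append] at h
      exact ⟨x, h, rfl⟩
    · rintro ⟨x, h, rfl⟩
      exact ⟨(wt_append _ _).trans h, (key _ _).2 rfl⟩
  rw [himage, Set.ncard_image_of_injective _ fun x y h => (append_inj.1 h).1,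
    ← Set.ncard_coe_finset, Finset.coe_filter_univ]

theorem wt_coset (hn : n = 44) (hR : R * Rᵀ = 1) (hrow : ∀ i, wt (R i) % 4 = 1)
    (hbR : ∀ x, 1 ≤ wt x → wt x ≤ 7 → 16 ≤ wt x + wt (x ᵥ* R) ∧ wt (x ᵥ* R) ≤ 32 + wt x)
    (hbT : ∀ x, 1 ≤ wt x → wt x ≤ 6 → 16 ≤ wt x + wt (x ᵥ* Rᵀ) ∧ wt (x ᵥ* Rᵀ) ≤ 32 + wt x)
    (x : Fin n → ZMod 2) : wt x + wt (x ᵥ* R + 1) = 12 ∨ 16 ≤ wt x + wt (x ᵥ* R + 1) := by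
  have h4 := wt_vecMul_mod_four hR hrow x
  have hc := wt_fin_add_one hn (x ᵥ* R)
  by_cases hx : x = 0
  · subst hx
    rw [zero_vecMul, wt_zero] at hc
    rw [zero_vecMul, wt_zero]
    omega
  have h1 := hbR x (wt_pos hx)
  have h2 := hbT (x ᵥ* R + 1)
  have hd := wt_fin_add_one hn ((x ᵥ* R + 1) ᵥ* Rᵀ)
  rw [complement_vecMul_transpose hR] at hd
  by_cases hz : x ᵥ* R + 1 = 0
  · rw [hz, zero_vecMul, wt_zero] at hd
    omega
  have := wt_pos hz
  omega

theorem card_low_eq_sum (hn : n = 44) (R : Matrix (Fin n) (Fin n) (ZMod 2)) (k : ℕ) :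
    (Finset.univ.filter fun x => wt x + wt (x ᵥ* R + 1) = 12 ∧ wt x ≤ k).card =
      ∑ i ∈ Finset.Icc 1 k,
        (Finset.univ.filter fun x => wt x = i ∧ wt (x ᵥ* R) = 32 + i).card := by
  rw [Finset.card_eq_sum_card_fiberwise (f := wt) (t := Finset.Icc 1 k)]
  · refine Finset.sum_congr rfl fun i hi => ?_
    rw [Finset.filter_filter]
    refine congrArg Finset.card (Finset.filter_congr fun x _ => ?_)
    have := wt_fin_add_one hn (x ᵥ* R)
    rw [Finset.mem_Icc] at hi
    omega
  · intro x hx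
    simp only [Finset.coe_filter, Set.mem_ofPred_eq] at hx
    have hc := wt_fin_add_one hn (x ᵥ* R)
    have h0 : wt x ≠ 0 := by
      intro h0
      have h := wt_eq_zero.1 h0
      subst h
      rw [zero_vecMul, wt_zero] at hc
      rw [zero_vecMul, wt_zero] at hx
      omega
    rw [Finset.coe_Icc, Set.mem_Icc]
    omega

theorem card_coset_twelve (hn : n = 44) (hR : R * Rᵀ = 1) :
    (Finset.univ.filter fun x => wt x + wt (x ᵥ* R + 1) = 12).card =
      ∑ i ∈ Finset.Icc 1 6,
        (Finset.univ.filter fun x => wt x = i ∧ wt (x ᵥ* R) = 32 + i).card +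
      ∑ i ∈ Finset.Icc 1 5,
        (Finset.univ.filter fun x => wt x = i ∧ wt (x ᵥ* Rᵀ) = 32 + i).card := by
  rw [← card_low_eq_sum hn R, ← card_low_eq_sum hn Rᵀ,
    ← Finset.card_filter_add_card_filter_not (fun x => wt x ≤ 6), Finset.filter_filter,
    Finset.filter_filter]
  congr 1
  refine Finset.card_nbij' (fun x => x ᵥ* R + 1) (fun z => z ᵥ* Rᵀ + 1) (fun x hx => ?_)
    (fun z hz => ?_) (fun x _ => complement_vecMul_transpose hR x)
    fun z _ => complement_transpose_vecMul hR z
  · simp only [Finset.coe_filter, Finset.mem_univ, true_and, Set.mem_ofPred_eq] at hx ⊢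
    rw [complement_vecMul_transpose hR]
    omega
  · simp only [Finset.coe_filter, Finset.mem_univ, true_and, Set.mem_ofPred_eq] at hz ⊢
    rw [complement_transpose_vecMul hR]
    omega

theorem Awt_sixteen_sysCode (hn : n = 44) (hR : R * Rᵀ = 1) (hrow : ∀ i, wt (R i) % 4 = 1)
    (hbR : ∀ x, 1 ≤ wt x → wt x ≤ 7 → 16 ≤ wt x + wt (x ᵥ* R) ∧ wt (x ᵥ* R) ≤ 32 + wt x)
    (hbT : ∀ x, 1 ≤ wt x → wt x ≤ 6 → 16 ≤ wt x + wt (x ᵥ* Rᵀ) ∧ wt (x ᵥ* Rᵀ) ≤ 32 + wt x)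
    (hN : ∑ i ∈ Finset.Icc 1 6,
        (Finset.univ.filter fun x => wt x = i ∧ wt (x ᵥ* R) = 32 + i).card +
      ∑ i ∈ Finset.Icc 1 5,
        (Finset.univ.filter fun x => wt x = i ∧ wt (x ᵥ* Rᵀ) = 32 + i).card = 264) :
    Awt (sysCode R) 16 = 18436 := by
  classical
  have h := Awt_sixteen_identity (C := sysCode R) (by rw [Fintype.card_fin, hn])
    (isSelfDual_sysCode hR) (by rw [finrank_sysCode, hn])
    (fun c hc h0 => sixteen_le_wt_of_mem_sysCode hR hrow hbR hbT hc h0) (Fin.append 1 0) ?_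
  · rw [Finset.sum_eq_single_of_mem 12 (by simp) fun j hj h0 => ?_, ncard_coset_eq hR,
      card_coset_twelve hn hR, hN, show krawCoeff 0 = 430848 from rfl,
      show krawCoeff 12 = 384 from rfl] at h
    · push_cast at h
      omega
    · rw [ncard_coset_eq hR, Finset.filter_false_of_mem, Finset.card_empty, Nat.cast_zero, mul_zero]
      intro x _ hx
      have := wt_coset hn hR hrow hbR hbT x
      rw [Finset.mem_range] at hj
      omega
  · rintro _ ⟨x, rfl⟩
    have h4 := wt_vecMul_mod_four hR hrow x
    have h2 : (1 : Fin n → ZMod 2) ⬝ᵥ x = (wt x : ZMod 2) := by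
      rw [natCast_wt]
      refine Finset.sum_congr rfl fun i _ => ?_
      have : ∀ a : ZMod 2, 1 * a = a * a := by decide
      exact this (x i)
    rw [sum_append_mul_append, zero_dotProduct, add_zero, h2, ZMod.natCast_eq_zero_iff, wt_append]
    omega

end singlyEven

namespace FourCirculant

open BitSlice Matrix

/-- The right half of the generator matrix of the code. -/
def right : Matrix (Fin 44) (Fin 44) (ZMod 2) := mat (rowsHead ++ rowsTail)

theorem right_transpose : rightᵀ = mat (colsHead ++ colsTail) := by
  have h : ∀ i j : Fin 44, ((rowsHead ++ rowsTail).getD j 0).testBit i =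
      ((colsHead ++ colsTail).getD i 0).testBit j := by decide +kernel
  ext i j
  simp only [transpose_apply, right, mat, of_apply, bitZ, h]

theorem right_mul_transpose : right * rightᵀ = 1 := by
  have h : ∀ i j : Fin 44, pop ((rowsHead ++ rowsTail).getD i 0 &&&
      (rowsHead ++ rowsTail).getD j 0) % 2 = if i = j then 1 else 0 := by decide +kernel
  ext i j
  have hcast := cast_pop_and ((rowsHead ++ rowsTail).getD i 0) ((rowsHead ++ rowsTail).getD j 0)
  rw [← ZMod.natCast_mod, h] at hcast
  rw [mul_apply, one_apply]
  simp only [transpose_apply, right, mat, of_apply, ← hcast]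
  split_ifs <;> simp

theorem wt_right_row (i : Fin 44) : wt (right i) % 4 = 1 := by
  have h : ∀ i : Fin 44, pop ((rowsHead ++ rowsTail).getD i 0) % 4 = 1 := by decide +kernel
  rw [← h i, pop_eq_wt]
  rfl

theorem right_bounds {x : Fin 44 → ZMod 2} (h1 : 1 ≤ wt x) (h7 : wt x ≤ 7) :
    16 ≤ wt x + wt (x ᵥ* right) ∧ wt (x ᵥ* right) ≤ 32 + wt x := by
  have key : ∃ N, count rowsHead rowsTail (wt x) = N ∧ N < 2 ^ 20 := by
    generalize wt x = i at h1 h7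
    interval_cases i
    · exact ⟨_, count_rows_one, by norm_num⟩
    · exact ⟨_, count_rows_two, by norm_num⟩
    · exact ⟨_, count_rows_three, by norm_num⟩
    · exact ⟨_, count_rows_four, by norm_num⟩
    · exact ⟨_, count_rows_five, by norm_num⟩
    · exact ⟨_, count_rows_six, by norm_num⟩
    · exact ⟨_, count_rows_seven, by norm_num⟩
  obtain ⟨N, h, hN⟩ := key
  have := (bounds_of_count h hN h7 rfl rfl).1 x rfl
  rw [right]
  omega

theorem right_transpose_bounds {x : Fin 44 → ZMod 2} (h1 : 1 ≤ wt x) (h6 : wt x ≤ 6) :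
    16 ≤ wt x + wt (x ᵥ* rightᵀ) ∧ wt (x ᵥ* rightᵀ) ≤ 32 + wt x := by
  have key : ∃ N, count colsHead colsTail (wt x) = N ∧ N < 2 ^ 20 := by
    generalize wt x = i at h1 h6
    interval_cases i
    · exact ⟨_, count_cols_one, by norm_num⟩
    · exact ⟨_, count_cols_two, by norm_num⟩
    · exact ⟨_, count_cols_three, by norm_num⟩
    · exact ⟨_, count_cols_four, by norm_num⟩
    · exact ⟨_, count_cols_five, by norm_num⟩
    · exact ⟨_, count_cols_six, by norm_num⟩
  obtain ⟨N, h, hN⟩ := key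
  have := (bounds_of_count h hN (by omega) rfl rfl).1 x rfl
  rw [right_transpose]
  omega

theorem card_right {i N : ℕ} (h : count rowsHead rowsTail i = N) (hN : N < 2 ^ 20) (hi : i ≤ 7) :
    (Finset.univ.filter fun x => wt x = i ∧ wt (x ᵥ* right) = 32 + i).card = N :=
  (bounds_of_count h hN hi rfl rfl).2

theorem card_right_transpose {i N : ℕ} (h : count colsHead colsTail i = N) (hN : N < 2 ^ 20)
    (hi : i ≤ 7) :
    (Finset.univ.filter fun x => wt x = i ∧ wt (x ᵥ* rightᵀ) = 32 + i).card = N := by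
  rw [right_transpose]
  exact (bounds_of_count h hN hi rfl rfl).2

theorem sum_Icc_eq {f g : ℕ → ℕ} (f₁ : f 1 = 0) (f₂ : f 2 = 22) (f₃ : f 3 = 0) (f₄ : f 4 = 33)
    (f₅ : f 5 = 44) (f₆ : f 6 = 88) (g₁ : g 1 = 0) (g₂ : g 2 = 0) (g₃ : g 3 = 0) (g₄ : g 4 = 77)
    (g₅ : g 5 = 0) : (Finset.Icc 1 6).sum f + (Finset.Icc 1 5).sum g = 264 := by
  simp [Finset.sum_Icc_succ_top, *]

theorem sum_card_eq :
    ∑ i ∈ Finset.Icc 1 6,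
        (Finset.univ.filter fun x => wt x = i ∧ wt (x ᵥ* right) = 32 + i).card +
      ∑ i ∈ Finset.Icc 1 5,
        (Finset.univ.filter fun x => wt x = i ∧ wt (x ᵥ* rightᵀ) = 32 + i).card = 264 :=
  sum_Icc_eq
    (card_right count_rows_one (by norm_num) (by norm_num))
    (card_right count_rows_two (by norm_num) (by norm_num))
    (card_right count_rows_three (by norm_num) (by norm_num))
    (card_right count_rows_four (by norm_num) (by norm_num))
    (card_right count_rows_five (by norm_num) (by norm_num))
    (card_right count_rows_six (by norm_num) (by norm_num))
    (card_right_transpose count_cols_one (by norm_num) (by norm_num))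
    (card_right_transpose count_cols_two (by norm_num) (by norm_num))
    (card_right_transpose count_cols_three (by norm_num) (by norm_num))
    (card_right_transpose count_cols_four (by norm_num) (by norm_num))
    (card_right_transpose count_cols_five (by norm_num) (by norm_num))

theorem sixteen_le_wt {c : Fin 88 → ZMod 2} (hc : c ∈ sysCode right) (h0 : c ≠ 0) : 16 ≤ wt c :=
  sixteen_le_wt_of_mem_sysCode right_mul_transpose wt_right_row (fun _ => right_bounds)
    (fun _ => right_transpose_bounds) hc h0

theorem Awt_sixteen : Awt (sysCode right) 16 = 18436 :=
  Awt_sixteen_sysCode rfl right_mul_transpose wt_right_row (fun _ => right_bounds)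
    (fun _ => right_transpose_bounds) sum_card_eq

theorem not_doublyEven : ¬∀ c ∈ sysCode right, 4 ∣ wt c := by
  intro h
  have h0 := h _ (append_mem_sysCode.2 (single_one_vecMul 0 right).symm)
  have h1 : wt (Pi.single 0 1 : Fin 44 → ZMod 2) = 1 := by
    rw [wt, Finset.card_eq_one]
    exact ⟨0, by ext j; simp [Pi.single_apply]⟩
  have h2 := wt_right_row 0
  rw [wt_append, h1] at h0
  change 4 ∣ 1 + wt (right 0) at h0
  omega

end FourCirculant

/-- There is a singly even self-dual `[88, 44, 16]` code whose weight
distribution is lexicographically smaller than that of every doubly even self-dual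
`[88, 44, 16]` code; it has 18436 codewords of weight 16, while every such doubly
even code has 32164. -/
theorem stmt_7 :
    ∃ C : Submodule (ZMod 2) (Fin 88 → ZMod 2),
      IsSelfDual C ∧ Module.finrank (ZMod 2) C = 44 ∧ HasMinWt C 16 ∧
      IsEvenCode C ∧ ¬ (∀ c ∈ C, 4 ∣ wt c) ∧
      Awt C 16 = 18436 ∧
      ∀ C' : Submodule (ZMod 2) (Fin 88 → ZMod 2),
        IsSelfDual C' → Module.finrank (ZMod 2) C' = 44 → HasMinWt C' 16 →
        (∀ c ∈ C', 4 ∣ wt c) →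
        LexSmaller C C' ∧ Awt C' 16 = 32164 := by
  refine ⟨sysCode FourCirculant.right, isSelfDual_sysCode FourCirculant.right_mul_transpose,
    finrank_sysCode (R := FourCirculant.right), ⟨?_, fun c => FourCirculant.sixteen_le_wt⟩,
    (isSelfDual_sysCode FourCirculant.right_mul_transpose).isEvenCode,
    FourCirculant.not_doublyEven, FourCirculant.Awt_sixteen, fun C' hC' hk hmin h4 => ?_⟩
  · have h : Awt (sysCode FourCirculant.right) 16 ≠ 0 := by
      rw [FourCirculant.Awt_sixteen]
      norm_num
    obtain ⟨c, hc, hw⟩ := Set.nonempty_of_ncard_ne_zero h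
    refine ⟨c, hc, ?_, hw⟩
    rintro rfl
    rw [wt_zero] at hw
    omega
  · have h16 := Awt_sixteen_of_doublyEven (by simp) hC' hk hmin.2 h4
    refine ⟨⟨16, fun i hi => ?_, ?_⟩, h16⟩
    · by_cases h0 : i = 0
      · rw [h0, Awt_zero, Awt_zero]
      · rw [Awt_eq_zero hmin.2 h0 hi]
        exact Awt_eq_zero (fun c => FourCirculant.sixteen_le_wt) h0 hi
    · rw [h16]
      exact FourCirculant.Awt_sixteen.trans_lt (by norm_num)
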